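/- Suppose Assumption A holds. Then: (a) the exponent α is uniquely determined; (b) h(κx) = κ^α h(x) for all κ > 0 and x ∈ (0,∞)^n, i.e., h is homogeneous of order α; (c) n + α > 0; and (d) for every bounded Borel set A ⊆ (0,∞)^n, lim_{κ→0^+} κ^{−α} ∫_A ρ(κx) dx = ∫_A h(x) dx < ∞, so in particular h is locally integrable. -/

import Mathlib

open MeasureTheory Filter

/-- The open unit simplex `Δ_n = {p ∈ (0,1)^n : p_1 + ⋯ + p_n = 1}`. -/
def openSimplex (n : ℕ) : Set (Fin n → ℝ) :=
  {p | (∀ i, 0 < p i ∧ p i < 1) ∧ ∑ i, p i = 1}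

/-- The open positive quadrant `(0,∞)^n`. -/
def quadrant (n : ℕ) : Set (Fin n → ℝ) := {x | ∀ i, 0 < x i}

lemma measurableSet_quadrant (n : ℕ) : MeasurableSet (quadrant n) := by
  have : quadrant n = ⋂ i, {x : Fin n → ℝ | 0 < x i} := by
    ext x; simp [quadrant]
  rw [this]
  exact MeasurableSet.iInter fun i => measurableSet_lt measurable_const (measurable_pi_apply i)

lemma smul_mem_quadrant {n : ℕ} {x : Fin n → ℝ} (hx : x ∈ quadrant n) {t : ℝ} (ht : 0 < t) :
    t • x ∈ quadrant n :=
  fun i => mul_pos ht (hx i)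

lemma sum_pos_of_mem_quadrant {n : ℕ} (hn : 0 < n) {x : Fin n → ℝ} (hx : x ∈ quadrant n) :
    0 < ∑ i, x i :=
  Finset.sum_pos (fun i _ => hx i) ⟨⟨0, hn⟩, Finset.mem_univ _⟩

lemma sum_smul_apply {n : ℕ} (t : ℝ) (x : Fin n → ℝ) : ∑ i, (t • x) i = t * ∑ i, x i := by
  simp [Finset.mul_sum]

lemma inv_sum_smul_mem_openSimplex {n : ℕ} (hn : 2 ≤ n) {x : Fin n → ℝ} (hx : x ∈ quadrant n) :
    (∑ i, x i)⁻¹ • x ∈ openSimplex n := by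
  have hs := sum_pos_of_mem_quadrant (by omega) hx
  refine ⟨fun i => ⟨mul_pos (inv_pos.2 hs) (hx i), ?_⟩, ?_⟩
  · have : Nontrivial (Fin n) := Fin.nontrivial_iff_two_le.2 hn
    obtain ⟨j, hj⟩ := exists_ne i
    have hlt : x i < ∑ k, x k :=
      Finset.single_lt_sum hj (Finset.mem_univ i) (Finset.mem_univ j) (hx j)
        fun k _ _ => (hx k).le
    rw [Pi.smul_apply, smul_eq_mul, inv_mul_lt_one₀ hs]
    exact hlt
  · rw [sum_smul_apply, inv_mul_cancel₀ hs.ne']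

/-- A pointwise limit of `ρ (κ • x) / κ ^ α` as `κ → 0⁺` is homogeneous of order `α`. -/
lemma map_smul_of_tendsto_div_rpow {E : Type*} [AddCommGroup E] [Module ℝ E]
    {ρ h : E → ℝ} {α : ℝ} {x : E} {t : ℝ} (ht : 0 < t)
    (hx : Tendsto (fun κ : ℝ => ρ (κ • x) / κ ^ α) (nhdsWithin 0 (Set.Ioi 0)) (nhds (h x)))
    (htx : Tendsto (fun κ : ℝ => ρ (κ • (t • x)) / κ ^ α) (nhdsWithin 0 (Set.Ioi 0))
      (nhds (h (t • x)))) :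
    h (t • x) = t ^ α * h x := by
  have hscale : Tendsto (fun κ : ℝ => κ * t) (nhdsWithin 0 (Set.Ioi 0))
      (nhdsWithin 0 (Set.Ioi 0)) := by
    refine tendsto_nhdsWithin_iff.2 ⟨?_, ?_⟩
    · have : Tendsto (fun κ : ℝ => κ * t) (nhds 0) (nhds (0 * t)) :=
        (continuous_id.mul continuous_const).tendsto 0
      rw [zero_mul] at this
      exact this.mono_left nhdsWithin_le_nhds
    · filter_upwards [self_mem_nhdsWithin] with κ hκ
      exact mul_pos hκ ht
  refine tendsto_nhds_unique htx (((hx.comp hscale).const_mul (t ^ α)).congr' ?_)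
  filter_upwards [self_mem_nhdsWithin] with κ hκ
  have hκ' : (0 : ℝ) < κ := hκ
  have h1 : t ^ α ≠ 0 := (Real.rpow_pos_of_pos ht α).ne'
  have h2 : κ ^ α ≠ 0 := (Real.rpow_pos_of_pos hκ' α).ne'
  simp only [Function.comp_apply, mul_smul]
  rw [Real.mul_rpow hκ'.le ht.le]
  field_simp

/-- If `f κ / κ ^ α` has a positive limit and `f κ / κ ^ β` converges as `κ → 0⁺`, then `β ≤ α`. -/
lemma exponent_le_of_tendsto_div_rpow {f : ℝ → ℝ} {α β a b : ℝ} (ha : 0 < a)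
    (hα : Tendsto (fun κ : ℝ => f κ / κ ^ α) (nhdsWithin 0 (Set.Ioi 0)) (nhds a))
    (hβ : Tendsto (fun κ : ℝ => f κ / κ ^ β) (nhdsWithin 0 (Set.Ioi 0)) (nhds b)) :
    β ≤ α := by
  by_contra! hlt
  have hpow : Tendsto (fun κ : ℝ => κ ^ (β - α)) (nhdsWithin 0 (Set.Ioi 0)) (nhds 0) := by
    have := (Real.continuousAt_rpow_const 0 (β - α) (Or.inr (sub_pos.2 hlt).le)).tendsto
    rw [Real.zero_rpow (sub_pos.2 hlt).ne'] at this
    exact this.mono_left nhdsWithin_le_nhds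
  have hlim := hβ.mul hpow
  rw [mul_zero] at hlim
  refine ha.ne' (tendsto_nhds_unique hα (hlim.congr' ?_))
  filter_upwards [self_mem_nhdsWithin] with κ hκ
  have hκ' : (0 : ℝ) < κ := hκ
  have h1 : κ ^ α ≠ 0 := (Real.rpow_pos_of_pos hκ' α).ne'
  have h2 : κ ^ β ≠ 0 := (Real.rpow_pos_of_pos hκ' β).ne'
  rw [Real.rpow_sub hκ']
  field_simp

/-- Uniform convergence on the simplex, spread over the quadrant by homogeneity. -/
lemma exists_abs_div_rpow_sub_le {n : ℕ} (hn : 2 ≤ n) {ρ h : (Fin n → ℝ) → ℝ} {α : ℝ}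
    (hhom : ∀ t : ℝ, 0 < t → ∀ x ∈ quadrant n, h (t • x) = t ^ α * h x)
    (hunif : TendstoUniformlyOn (fun (κ : ℝ) (x : Fin n → ℝ) => ρ (κ • x) / κ ^ α) h
      (nhdsWithin 0 (Set.Ioi 0)) (openSimplex n)) {ε : ℝ} (hε : 0 < ε) :
    ∃ δ > 0, ∀ κ : ℝ, 0 < κ → ∀ x ∈ quadrant n, κ * ∑ i, x i < δ →
      |ρ (κ • x) / κ ^ α - h x| ≤ ε * (∑ i, x i) ^ α := by
  obtain ⟨δ, hδ, hball⟩ := mem_nhdsGT_iff_exists_Ioo_subset.1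
    (Metric.tendstoUniformlyOn_iff.1 hunif ε hε)
  refine ⟨δ, hδ, fun κ hκ x hx hlt => ?_⟩
  have hs := sum_pos_of_mem_quadrant (by omega) hx
  have hp := inv_sum_smul_mem_openSimplex hn hx
  have hclose := hball (show κ * ∑ i, x i ∈ Set.Ioo 0 δ from ⟨mul_pos hκ hs, hlt⟩) _ hp
  set s := ∑ i, x i
  have hsα : 0 < s ^ α := Real.rpow_pos_of_pos hs α
  have hκα : 0 < κ ^ α := Real.rpow_pos_of_pos hκ α
  rw [dist_comm, Real.dist_eq, smul_smul, mul_assoc, mul_inv_cancel₀ hs.ne', mul_one,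
    hhom _ (inv_pos.2 hs) x hx, Real.mul_rpow hκ.le hs.le, Real.inv_rpow hs.le] at hclose
  have heq : ρ (κ • x) / κ ^ α - h x =
      s ^ α * (ρ (κ • x) / (κ ^ α * s ^ α) - (s ^ α)⁻¹ * h x) := by
    field_simp
  rw [heq, abs_mul, abs_of_pos hsα, mul_comm ε]
  exact mul_le_mul_of_nonneg_left hclose.le hsα.le

/-- On the positive quadrant `(∑ i, x i) ^ α` is locally integrable when `0 < n + α`. -/
lemma integrableOn_sum_rpow {n : ℕ} (hn : 0 < n) {α : ℝ} (hα : 0 < (n : ℝ) + α)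
    {A : Set (Fin n → ℝ)} (hA : A ⊆ quadrant n) (hAmeas : MeasurableSet A)
    (hbdd : Bornology.IsBounded A) :
    IntegrableOn (fun x => (∑ i, x i) ^ α) A volume := by
  obtain ⟨R, hR⟩ := hbdd.subset_ball 0
  have hmeas : Measurable fun x : Fin n → ℝ => (∑ i, x i) ^ α := by fun_prop
  have hfin : Module.finrank ℝ (Fin n → ℝ) = n := by simp
  have key : IntegrableOn ((quadrant n).indicator fun x => (∑ i, x i) ^ α) (Metric.ball 0 R)
      volume := by
    refine integrableOn_ball_of_norm_le_rpow (C := max 1 ((n : ℝ) ^ α)) (α := -α)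
      (by rw [hfin]; omega) (by rw [hfin]; linarith) (ae_of_all _ fun x => ?_)
      (hmeas.indicator (measurableSet_quadrant n)).aestronglyMeasurable
    rw [neg_neg]
    have hxα : 0 ≤ ‖x‖ ^ α := Real.rpow_nonneg (norm_nonneg x) α
    by_cases hx : x ∈ quadrant n
    · have hs := sum_pos_of_mem_quadrant hn hx
      have hle : ‖x‖ ≤ ∑ i, x i := by
        refine (pi_norm_le_iff_of_nonneg hs.le).2 fun i => ?_
        rw [Real.norm_of_nonneg (hx i).le]
        exact Finset.single_le_sum (fun j _ => (hx j).le) (Finset.mem_univ i)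
      have hge : ∑ i, x i ≤ n * ‖x‖ := by
        calc ∑ i, x i ≤ ∑ _i : Fin n, ‖x‖ :=
              Finset.sum_le_sum fun i _ => (le_abs_self _).trans (norm_le_pi_norm x i)
          _ = n * ‖x‖ := by simp
      have hxpos : 0 < ‖x‖ :=
        pos_of_mul_pos_right (hs.trans_le hge) (Nat.cast_nonneg n)
      rw [Set.indicator_of_mem hx, Real.norm_of_nonneg (Real.rpow_nonneg hs.le α)]
      rcases le_total 0 α with h0 | h0
      · calc (∑ i, x i) ^ α ≤ (n * ‖x‖) ^ α := Real.rpow_le_rpow hs.le hge h0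
          _ = (n : ℝ) ^ α * ‖x‖ ^ α := Real.mul_rpow (Nat.cast_nonneg n) hxpos.le
          _ ≤ _ := mul_le_mul_of_nonneg_right (le_max_right _ _) hxα
      · calc (∑ i, x i) ^ α ≤ 1 * ‖x‖ ^ α := by
              rw [one_mul]; exact Real.rpow_le_rpow_of_nonpos hxpos hle h0
          _ ≤ _ := mul_le_mul_of_nonneg_right (le_max_left _ _) hxα
    · rw [Set.indicator_of_notMem hx, norm_zero]
      positivity
  exact (key.mono_set hR).congr_fun (fun x hx => Set.indicator_of_mem (hA hx) _) hAmeas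

open scoped Pointwise in
/-- A positive function, homogeneous of order `α` on a nonnull cone of the quadrant, can be
integrable near the origin only if `0 < n + α`. -/
lemma dim_add_order_pos {n : ℕ} (hn : 0 < n) {h : (Fin n → ℝ) → ℝ} {α : ℝ}
    {E : Set (Fin n → ℝ)} (hEq : E ⊆ quadrant n) (hEmeas : MeasurableSet E)
    (hcone : ∀ t : ℝ, 0 < t → ∀ x ∈ E, t • x ∈ E)
    (hhom : ∀ t : ℝ, 0 < t → ∀ x ∈ E, h (t • x) = t ^ α * h x)
    (hpos : ∀ x ∈ E, 0 < h x) (hE : volume E ≠ 0) {r : ℝ} (hr : 0 < r)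
    (hint : IntegrableOn h (E ∩ {x | ∑ i, x i < r}) volume) :
    0 < (n : ℝ) + α := by
  by_contra! hle
  set S : ℝ → Set (Fin n → ℝ) := fun t => E ∩ {x | ∑ i, x i < t * r} with hS
  have hSmeas : ∀ t, MeasurableSet (S t) := fun t =>
    hEmeas.inter (measurableSet_lt (by fun_prop) measurable_const)
  have hS1 : S 1 = E ∩ {x | ∑ i, x i < r} := by simp [hS]
  rw [← hS1] at hint
  have hsmul : ∀ t : ℝ, 0 < t → t • S 1 = S t := by
    intro t ht
    ext x
    rw [Set.mem_smul_set_iff_inv_smul_mem₀ ht.ne']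
    simp only [hS, Set.mem_inter_iff, Set.mem_ofPred_eq, sum_smul_apply, one_mul]
    rw [inv_mul_lt_iff₀ ht]
    refine and_congr_left fun _ => ⟨fun hx => ?_, fun hx => hcone _ (inv_pos.2 ht) x hx⟩
    simpa [smul_smul, ht.ne'] using hcone t ht _ hx
  have hscale : ∀ t : ℝ, 0 < t → ∫ x in S t, h x = t ^ ((n : ℝ) + α) * ∫ x in S 1, h x := by
    intro t ht
    have h1 := Measure.setIntegral_comp_smul_of_pos volume h (S 1) ht
    rw [hsmul t ht, setIntegral_congr_fun (hSmeas 1) fun x hx => hhom t ht x hx.1,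
      integral_const_mul] at h1
    rw [Real.rpow_add ht, mul_assoc, h1, Real.rpow_natCast]
    simp [ht.ne']
  have hnn : 0 ≤ ∫ x in S 1, h x := setIntegral_nonneg (hSmeas 1) fun x hx => (hpos x hx.1).le
  have hanti : Antitone fun k : ℕ => S (1 / ((k : ℝ) + 1)) := by
    intro a b hab x hx
    exact ⟨hx.1, lt_of_lt_of_le hx.2
      (mul_le_mul_of_nonneg_right (Nat.one_div_le_one_div hab) hr.le)⟩
  have hempty : ⋂ k : ℕ, S (1 / ((k : ℝ) + 1)) = ∅ := by
    refine Set.eq_empty_of_forall_notMem fun x hx => ?_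
    rw [Set.mem_iInter] at hx
    have hs := sum_pos_of_mem_quadrant hn (hEq (hx 0).1)
    obtain ⟨k, hk⟩ := exists_nat_one_div_lt (div_pos hs hr)
    exact absurd ((lt_div_iff₀ hr).1 hk) (not_lt.2 (hx k).2.le)
  have hlim : Tendsto (fun k : ℕ => ∫ x in S (1 / ((k : ℝ) + 1)), h x) atTop (nhds 0) := by
    have := tendsto_setIntegral_of_antitone (μ := volume) (f := h) (fun k => hSmeas _) hanti
      ⟨0, by simpa using hint⟩
    rwa [hempty, setIntegral_empty] at this
  have hzero : ∫ x in S 1, h x = 0 := by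
    refine le_antisymm (ge_of_tendsto' hlim fun k => ?_) hnn
    have hk : (0 : ℝ) < 1 / ((k : ℝ) + 1) := Nat.one_div_pos_of_nat
    rw [hscale _ hk]
    refine le_mul_of_one_le_left hnn (Real.one_le_rpow_of_pos_of_le_one_of_nonpos hk ?_ hle)
    exact (Nat.one_div_le_one_div (Nat.zero_le k)).trans_eq (by simp)
  have hnull : volume (S 1) = 0 := by
    have hae := (setIntegral_eq_zero_iff_of_nonneg_ae
      (ae_restrict_of_forall_mem (hSmeas 1) fun x hx => (hpos x hx.1).le) hint).1 hzero
    rw [Filter.EventuallyEq, ae_restrict_iff' (hSmeas 1)] at hae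
    rw [measure_eq_zero_iff_ae_notMem]
    filter_upwards [hae] with x hx hmem
    exact (hpos x hmem.1).ne' (hx hmem)
  have hcover : E ⊆ ⋃ k : ℕ, S ((k : ℝ) + 1) := by
    intro x hx
    obtain ⟨k, hk⟩ := exists_nat_gt ((∑ i, x i) / r)
    refine Set.mem_iUnion.2 ⟨k, hx, ?_⟩
    rw [div_lt_iff₀ hr] at hk
    exact hk.trans (by nlinarith)
  refine hE (measure_mono_null hcover (measure_iUnion_null fun k => ?_))
  rw [← hsmul _ (Nat.cast_add_one_pos k), Measure.addHaar_smul, hnull, mul_zero]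

/-- consequences of Assumption A.  If `ρ` is a probability density on
`(0,∞)^n` and `ρ(κx)/κ^α → h(x)` as `κ → 0⁺` pointwise on `(0,∞)^n`, uniformly on
`Δ_n`, where `h ≥ 0` has `∫ h ∈ (0,∞]`, then: (a) `α` is uniquely determined;
(b) `h` is homogeneous of order `α`; (c) `n + α > 0`; (d) for every bounded Borel
`A ⊆ (0,∞)^n`, `κ^{−α} ∫_A ρ(κx) dx → ∫_A h(x) dx < ∞`. -/
theorem assumption_consequences (n : ℕ) (hn : 2 ≤ n)
    (ρ : (Fin n → ℝ) → ℝ) (hρmeas : Measurable ρ) (hρnonneg : ∀ x, 0 ≤ ρ x)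
    (hρprob : ∫⁻ x in quadrant n, ENNReal.ofReal (ρ x) = 1)
    (α : ℝ) (h : (Fin n → ℝ) → ℝ) (hhmeas : Measurable h)
    (hhnonneg : ∀ x ∈ quadrant n, 0 ≤ h x)
    (hhpos : 0 < ∫⁻ x in quadrant n, ENNReal.ofReal (h x))
    (hpt : ∀ x ∈ quadrant n,
      Tendsto (fun κ : ℝ => ρ (κ • x) / κ ^ α) (nhdsWithin 0 (Set.Ioi 0)) (nhds (h x)))
    (hunif : TendstoUniformlyOn (fun (κ : ℝ) (x : Fin n → ℝ) => ρ (κ • x) / κ ^ α) h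
      (nhdsWithin 0 (Set.Ioi 0)) (openSimplex n)) :
    -- (a) the exponent `α` is uniquely determined
    (∀ (α' : ℝ) (h' : (Fin n → ℝ) → ℝ), Measurable h' →
      (∀ x ∈ quadrant n, 0 ≤ h' x) →
      0 < (∫⁻ x in quadrant n, ENNReal.ofReal (h' x)) →
      (∀ x ∈ quadrant n, Tendsto (fun κ : ℝ => ρ (κ • x) / κ ^ α')
        (nhdsWithin 0 (Set.Ioi 0)) (nhds (h' x))) →
      TendstoUniformlyOn (fun (κ : ℝ) (x : Fin n → ℝ) => ρ (κ • x) / κ ^ α') h'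
        (nhdsWithin 0 (Set.Ioi 0)) (openSimplex n) →
      α' = α) ∧
    -- (b) homogeneity of order `α`
    (∀ κ : ℝ, 0 < κ → ∀ x ∈ quadrant n, h (κ • x) = κ ^ α * h x) ∧
    -- (c) `n + α > 0`
    (0 < (n : ℝ) + α) ∧
    -- (d) convergence of integrals over bounded Borel sets, and local integrability
    (∀ A : Set (Fin n → ℝ), A ⊆ quadrant n → MeasurableSet A → Bornology.IsBounded A →
      IntegrableOn h A volume ∧
      Tendsto (fun κ : ℝ => (∫ x in A, ρ (κ • x)) / κ ^ α)
        (nhdsWithin 0 (Set.Ioi 0)) (nhds (∫ x in A, h x))) := by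
  have hn0 : 0 < n := by omega
  have hQ := measurableSet_quadrant n
  have hρint : IntegrableOn ρ (quadrant n) volume := by
    refine ⟨hρmeas.aestronglyMeasurable, ?_⟩
    rw [hasFiniteIntegral_iff_ofReal (ae_of_all _ hρnonneg), hρprob]
    exact ENNReal.one_lt_top
  have hhom : ∀ t : ℝ, 0 < t → ∀ x ∈ quadrant n, h (t • x) = t ^ α * h x :=
    fun t ht x hx =>
      map_smul_of_tendsto_div_rpow ht (hpt x hx) (hpt _ (smul_mem_quadrant hx ht))
  have hdim : 0 < (n : ℝ) + α := by
    set E : ℕ → Set (Fin n → ℝ) := fun m =>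
      quadrant n ∩ {x | 1 / ((m : ℝ) + 1) * (∑ i, x i) ^ α < h x} with hE
    have hEmeas : ∀ m, MeasurableSet (E m) := fun m =>
      hQ.inter (measurableSet_lt (by fun_prop) hhmeas)
    obtain ⟨m, hm⟩ : ∃ m, volume (E m) ≠ 0 := by
      by_contra! hnull
      refine hhpos.ne' ((setLIntegral_eq_zero_iff hQ (by fun_prop)).2 ?_)
      have h0 := measure_eq_zero_iff_ae_notMem.1 (measure_iUnion_null hnull)
      filter_upwards [h0] with x hx hxQ
      rw [ENNReal.ofReal_eq_zero]
      by_contra! hxpos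
      have hsα := Real.rpow_pos_of_pos (sum_pos_of_mem_quadrant hn0 hxQ) α
      obtain ⟨m, hm⟩ := exists_nat_one_div_lt (div_pos hxpos hsα)
      exact hx (Set.mem_iUnion.2 ⟨m, hxQ, (lt_div_iff₀ hsα).1 hm⟩)
    have hc : (0 : ℝ) < 1 / ((m : ℝ) + 1) := Nat.one_div_pos_of_nat
    obtain ⟨δ, hδ, hclose⟩ := exists_abs_div_rpow_sub_le hn hhom hunif (half_pos hc)
    have hEpos : ∀ x ∈ E m, 0 < h x := fun x hx =>
      (mul_pos hc (Real.rpow_pos_of_pos (sum_pos_of_mem_quadrant hn0 hx.1) α)).trans hx.2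
    refine dim_add_order_pos hn0 Set.inter_subset_left (hEmeas m) (fun t ht x hx => ?_)
      (fun t ht x hx => hhom t ht x hx.1) hEpos hm hδ ?_
    · refine ⟨smul_mem_quadrant hx.1 ht, ?_⟩
      rw [Set.mem_ofPred_eq, sum_smul_apply, hhom t ht x hx.1,
        Real.mul_rpow ht.le (sum_pos_of_mem_quadrant hn0 hx.1).le, mul_left_comm]
      exact mul_lt_mul_of_pos_left hx.2 (Real.rpow_pos_of_pos ht α)
    · refine Integrable.mono' ((hρint.mono_set (Set.inter_subset_left.trans
        Set.inter_subset_left)).const_mul 2) hhmeas.aestronglyMeasurable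
        (ae_restrict_of_forall_mem ((hEmeas m).inter
          (measurableSet_lt (by fun_prop) measurable_const)) fun x hx => ?_)
      have h1 := hclose 1 one_pos x hx.1.1 (by rw [one_mul]; exact hx.2)
      rw [one_smul, Real.one_rpow, div_one, abs_le] at h1
      have h2 : 1 / ((m : ℝ) + 1) * (∑ i, x i) ^ α < h x := hx.1.2
      rw [Real.norm_of_nonneg (hEpos x hx.1).le]
      linarith [h1.1]
  refine ⟨?_, hhom, hdim, ?_⟩
  · have exists_pos : ∀ g : (Fin n → ℝ) → ℝ,
        0 < (∫⁻ x in quadrant n, ENNReal.ofReal (g x)) → ∃ x ∈ quadrant n, 0 < g x := by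
      intro g hg
      by_contra! hle
      refine hg.ne' ?_
      rw [setLIntegral_congr_fun hQ fun x hx => ENNReal.ofReal_of_nonpos (hle x hx)]
      simp
    intro α' h' _ _ hpos' hpt' _
    obtain ⟨x, hx, hxpos⟩ := exists_pos h hhpos
    obtain ⟨y, hy, hypos⟩ := exists_pos h' hpos'
    exact le_antisymm (exponent_le_of_tendsto_div_rpow hxpos (hpt x hx) (hpt' x hx))
      (exponent_le_of_tendsto_div_rpow hypos (hpt' y hy) (hpt y hy))
  · intro A hA hAmeas hbdd
    have hw := integrableOn_sum_rpow hn0 hdim hA hAmeas hbdd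
    have hρA : ∀ κ : ℝ, 0 < κ → IntegrableOn (fun x => ρ (κ • x) / κ ^ α) A volume := by
      intro κ hκ
      have h1 := ((integrable_indicator_iff hQ).2 hρint).comp_smul hκ.ne'
      refine (h1.integrableOn.congr_fun (fun x hx => ?_) hAmeas).div_const _
      exact Set.indicator_of_mem (smul_mem_quadrant (hA hx) hκ) _
    obtain ⟨R, hR, hsum⟩ : ∃ R > 0, ∀ x ∈ A, ∑ i, x i < R := by
      obtain ⟨M, hM, hbound⟩ := hbdd.exists_pos_norm_lt
      refine ⟨n * M, by positivity, fun x hx => ?_⟩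
      have : Nonempty (Fin n) := ⟨⟨0, hn0⟩⟩
      calc ∑ i, x i < ∑ _i : Fin n, M := Finset.sum_lt_sum_of_nonempty Finset.univ_nonempty
            fun i _ => ((le_abs_self _).trans (norm_le_pi_norm x i)).trans_lt (hbound x hx)
        _ = n * M := by simp
    have hclose : ∀ ε : ℝ, 0 < ε → ∃ δ > 0, ∀ κ ∈ Set.Ioo 0 δ, ∀ x ∈ A,
        |ρ (κ • x) / κ ^ α - h x| ≤ ε * (∑ i, x i) ^ α := by
      intro ε hε
      obtain ⟨δ, hδ, hclose⟩ := exists_abs_div_rpow_sub_le hn hhom hunif hε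
      refine ⟨δ / R, div_pos hδ hR, fun κ hκ x hx => hclose κ hκ.1 x (hA hx) ?_⟩
      exact (mul_lt_mul_of_pos_left (hsum x hx) hκ.1).trans ((lt_div_iff₀ hR).1 hκ.2)
    have hh : IntegrableOn h A volume := by
      obtain ⟨δ, hδ, hδ'⟩ := hclose 1 one_pos
      have hκ : δ / 2 ∈ Set.Ioo 0 δ := ⟨half_pos hδ, half_lt_self hδ⟩
      refine Integrable.mono' ((hρA _ hκ.1).add hw) hhmeas.aestronglyMeasurable
        (ae_restrict_of_forall_mem hAmeas fun x hx => ?_)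
      have h1 := (abs_le.1 (hδ' _ hκ x hx)).1
      rw [Real.norm_of_nonneg (hhnonneg x (hA hx)), Pi.add_apply]
      linarith
    refine ⟨hh, Metric.tendsto_nhds.2 fun ε hε => ?_⟩
    set W := ∫ x in A, (∑ i, x i) ^ α
    have hW : 0 ≤ W := setIntegral_nonneg hAmeas fun x hx =>
      (Real.rpow_pos_of_pos (sum_pos_of_mem_quadrant hn0 (hA hx)) α).le
    have hW1 : 0 < W + 1 := by linarith
    obtain ⟨δ, hδ, hδ'⟩ := hclose (ε / (W + 1)) (div_pos hε hW1)
    filter_upwards [Ioo_mem_nhdsGT hδ] with κ hκ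
    rw [Real.dist_eq, ← integral_div, ← integral_sub (hρA κ hκ.1) hh]
    calc |∫ x in A, (ρ (κ • x) / κ ^ α - h x)|
        ≤ ∫ x in A, ε / (W + 1) * (∑ i, x i) ^ α :=
          (Real.norm_eq_abs _).symm.trans_le (norm_integral_le_of_norm_le (hw.const_mul _)
            (ae_restrict_of_forall_mem hAmeas fun x hx => hδ' κ hκ x hx))
      _ = ε / (W + 1) * W := integral_const_mul _ _
      _ < ε := by
        rw [div_mul_eq_mul_div, div_lt_iff₀ hW1]
        nlinarith
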